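/- Let n ≥ 2 and ℓ ≥ 1, and let q: ℝ^n → ℝ be a homogeneous polynomial of degree ℓ that is harmonic (Σ_{i=1}^n ∂²q/∂x_i² = 0 on ℝ^n) and satisfies ∫_{S^{n-1}} q² dσ = 1. Let λ = ℓ(ℓ + n − 2), so that the restriction of q to S^{n-1} is an eigenfunction of the spherical Laplacian with eigenvalue −λ. Then d_TV(q(X), Z) ≤ (2/λ) · 𝔼| ‖∇_S q(X)‖² − 𝔼‖∇_S q(X)‖² |. -/

import Mathlib

open MeasureTheory ProbabilityTheory Real Finset
open scoped RealInnerProductSpace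

noncomputable section

/-- total variation distance between two (Borel) measures on ℝ -/
def dTV (μ ν : MeasureTheory.Measure ℝ) : ℝ :=
  ⨆ s : {s : Set ℝ // MeasurableSet s}, |(μ s.1).toReal - (ν s.1).toReal|

/-- uniform probability measure on the unit sphere of a Euclidean space -/
def sphereUniform (ι : Type*) [Fintype ι] :
    MeasureTheory.Measure (Metric.sphere (0 : EuclideanSpace ℝ ι) 1) :=
  ((volume : MeasureTheory.Measure (EuclideanSpace ℝ ι)).toSphere Set.univ)⁻¹ •
    (volume : MeasureTheory.Measure (EuclideanSpace ℝ ι)).toSphere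

/-- spherical gradient: `∇_S h(x) = ∇h(x) − ⟨∇h(x), x⟩ x` -/
def sphGrad {ι : Type*} [Fintype ι] (h : EuclideanSpace ℝ ι → ℝ)
    (x : EuclideanSpace ℝ ι) : EuclideanSpace ℝ ι :=
  gradient h x - ⟪gradient h x, x⟫ • x

/-- Two probability measures whose integrals of continuous `[0, 1]`-valued functions differ by at
most `C` differ by at most `C` on every measurable set. -/
lemma abs_measure_sub_le_of_continuous (μ ν : Measure ℝ) [IsProbabilityMeasure μ]
    [IsProbabilityMeasure ν] (C : ℝ)
    (H : ∀ h : ℝ → ℝ, Continuous h → (∀ x, 0 ≤ h x) → (∀ x, h x ≤ 1) →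
      |∫ x, h x ∂μ - ∫ x, h x ∂ν| ≤ C) (A : Set ℝ) (hA : MeasurableSet A) :
    |(μ A).toReal - (ν A).toReal| ≤ C := by
  refine le_of_forall_pos_le_add fun ε hε => ?_
  have hi : ∀ (ρ : Measure ℝ) [IsFiniteMeasure ρ], Integrable (A.indicator fun _ => (1 : ℝ)) ρ :=
    fun ρ _ => (integrable_const 1).indicator hA
  obtain ⟨g, hg, -⟩ := (hi (μ + ν)).exists_boundedContinuous_integral_sub_le hε
  set h : ℝ → ℝ := fun x => max 0 (min 1 (g x)) with hh
  have hc : Continuous h := by fun_prop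
  have h0 : ∀ x, 0 ≤ h x := fun x => le_max_left _ _
  have h1 : ∀ x, h x ≤ 1 := fun x => max_le zero_le_one (min_le_left _ _)
  have hint : ∀ (ρ : Measure ℝ) [IsFiniteMeasure ρ], Integrable h ρ := fun ρ _ =>
    Integrable.of_bound hc.aestronglyMeasurable 1
      (Filter.Eventually.of_forall fun x => by rw [norm_eq_abs, abs_of_nonneg (h0 x)]; exact h1 x)
  have hpt : ∀ x, |A.indicator (fun _ => (1 : ℝ)) x - h x| ≤
      ‖A.indicator (fun _ => (1 : ℝ)) x - g x‖ := by
    intro x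
    rw [norm_eq_abs, hh]
    by_cases hx : x ∈ A
    · simp only [Set.indicator_of_mem hx]
      rcases le_total (g x) 1 with h | h <;> rcases le_total 0 (g x) with h' | h' <;>
        simp [h, h'] <;> grind
    · simp only [Set.indicator_of_notMem hx]
      rcases le_total (g x) 1 with h | h <;> rcases le_total 0 (g x) with h' | h' <;>
        simp [h, h'] <;> grind
  have hsum : ∫ x, |A.indicator (fun _ => (1 : ℝ)) x - h x| ∂μ +
      ∫ x, |A.indicator (fun _ => (1 : ℝ)) x - h x| ∂ν ≤ ε := by
    have hia : ∀ (ρ : Measure ℝ) [IsFiniteMeasure ρ],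
        Integrable (fun x => |A.indicator (fun _ => (1 : ℝ)) x - h x|) ρ :=
      fun ρ _ => ((hi ρ).sub (hint ρ)).abs
    rw [← integral_add_measure (hia μ) (hia ν)]
    refine le_trans (integral_mono (hia _) ?_ hpt) hg
    exact ((hi _).sub (g.integrable _)).norm
  have key : ∀ (ρ : Measure ℝ) [IsProbabilityMeasure ρ], |(ρ A).toReal - ∫ x, h x ∂ρ| ≤
      ∫ x, |A.indicator (fun _ => (1 : ℝ)) x - h x| ∂ρ := by
    intro ρ _
    have : (ρ A).toReal = ∫ x, A.indicator (fun _ => (1 : ℝ)) x ∂ρ := by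
      rw [integral_indicator hA]; simp [Measure.real]
    rw [this, ← integral_sub (hi ρ) (hint ρ)]
    exact abs_integral_le_integral_abs
  have k1 := key μ
  have k2 := key ν
  have k3 := H h hc h0 h1
  rw [abs_le] at *
  constructor <;> linarith

lemma integrable_exp_neg_sq_div_two : Integrable (fun t : ℝ => exp (-(t ^ 2 / 2))) := by
  have := integrable_exp_neg_mul_sq (b := 1 / 2) (by norm_num)
  refine this.congr (Filter.Eventually.of_forall fun t => ?_)
  simp only; congr 1; ring

lemma hasDerivAt_exp_sq_div_two (x : ℝ) :
    HasDerivAt (fun t : ℝ => exp (t ^ 2 / 2)) (x * exp (x ^ 2 / 2)) x := by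
  refine ((hasDerivAt_pow 2 x).div_const 2).exp.congr_deriv ?_
  norm_num; ring

lemma hasDerivAt_neg_exp_neg_sq_div_two (x : ℝ) :
    HasDerivAt (fun t : ℝ => -exp (-(t ^ 2 / 2))) (x * exp (-(x ^ 2 / 2))) x := by
  refine ((hasDerivAt_pow 2 x).div_const 2).fun_neg.exp.fun_neg.congr_deriv ?_
  norm_num; ring

lemma integrable_mul_exp_neg_sq_div_two {k : ℝ → ℝ} (hk : Continuous k) {c : ℝ}
    (hb : ∀ x, |k x| ≤ c) : Integrable (fun t : ℝ => k t * exp (-(t ^ 2 / 2))) :=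
  integrable_exp_neg_sq_div_two.bdd_mul hk.aestronglyMeasurable
    (Filter.Eventually.of_forall hb)

/-- Mills-ratio bound for a Gaussian tail integral against a function bounded by one. -/
lemma mul_abs_integral_Ioi_le {k : ℝ → ℝ} (hk : Continuous k) (hb : ∀ x, |k x| ≤ 1)
    {x : ℝ} (hx : 0 ≤ x) :
    x * |∫ t in Set.Ioi x, k t * exp (-(t ^ 2 / 2))| ≤ exp (-(x ^ 2 / 2)) := by
  have hI : Integrable (fun t : ℝ => t * exp (-(t ^ 2 / 2))) := by
    have := integrable_mul_exp_neg_mul_sq (b := 1 / 2) (by norm_num)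
    refine this.congr (Filter.Eventually.of_forall fun t => ?_)
    simp only; congr 2; ring
  have hlim : Filter.Tendsto (fun t : ℝ => -exp (-(t ^ 2 / 2))) Filter.atTop (nhds 0) := by
    rw [← neg_zero]
    refine (tendsto_exp_neg_atTop_nhds_zero.comp ?_).neg
    exact (Filter.tendsto_pow_atTop (by norm_num)).atTop_div_const (by norm_num)
  have hval := integral_Ioi_of_hasDerivAt_of_tendsto' (a := x)
    (fun t _ => hasDerivAt_neg_exp_neg_sq_div_two t) hI.integrableOn hlim
  have h1 : |∫ t in Set.Ioi x, k t * exp (-(t ^ 2 / 2))| ≤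
      ∫ t in Set.Ioi x, exp (-(t ^ 2 / 2)) := by
    refine abs_integral_le_integral_abs.trans ?_
    refine integral_mono (integrable_mul_exp_neg_sq_div_two hk hb).abs.integrableOn
      integrable_exp_neg_sq_div_two.integrableOn fun t => ?_
    simp only [abs_mul, abs_exp]
    exact mul_le_of_le_one_left (exp_pos _).le (hb t)
  calc _ ≤ x * ∫ t in Set.Ioi x, exp (-(t ^ 2 / 2)) := by gcongr
    _ = ∫ t in Set.Ioi x, x * exp (-(t ^ 2 / 2)) := (integral_const_mul _ _).symm
    _ ≤ ∫ t in Set.Ioi x, t * exp (-(t ^ 2 / 2)) := by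
        refine setIntegral_mono_on (integrable_exp_neg_sq_div_two.const_mul x).integrableOn
          hI.integrableOn measurableSet_Ioi fun t ht => ?_
        have : x ≤ t := le_of_lt ht
        gcongr
    _ = _ := by rw [hval]; ring

/-- Solution of Stein's equation for a continuous test function. -/
lemma exists_stein_solution {h : ℝ → ℝ} (hc : Continuous h) (h0 : ∀ x, 0 ≤ h x)
    (h1 : ∀ x, h x ≤ 1) :
    ∃ f f' : ℝ → ℝ, (∀ x, HasDerivAt f (f' x) x) ∧ Continuous f' ∧ (∀ x, |f' x| ≤ 2) ∧
      ∀ x, f' x - x * f x = h x - ∫ t, h t ∂(gaussianReal 0 1) := by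
  set c := ∫ t, h t ∂(gaussianReal 0 1) with hcdef
  set k : ℝ → ℝ := fun x => h x - c with hk
  have hkc : Continuous k := by fun_prop
  have hint : Integrable h (gaussianReal 0 1) :=
    Integrable.of_bound hc.aestronglyMeasurable 1
      (Filter.Eventually.of_forall fun x => by rw [norm_eq_abs, abs_of_nonneg (h0 x)]; exact h1 x)
  have c0 : 0 ≤ c := integral_nonneg h0
  have c1 : c ≤ 1 := by
    refine (integral_mono hint (integrable_const 1) h1).trans (by simp)
  have hb : ∀ x, |k x| ≤ 1 := fun x => by
    have := h0 x; have := h1 x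
    rw [abs_le]; constructor <;> simp only [hk] <;> linarith
  have hkI := integrable_mul_exp_neg_sq_div_two hkc hb
  have hkzero : ∫ t, k t * exp (-(t ^ 2 / 2)) = 0 := by
    have e1 : ∫ t, k t ∂(gaussianReal 0 1) = 0 := by
      simp only [hk]
      rw [integral_sub hint (integrable_const _)]
      simp [hcdef]
    rw [integral_gaussianReal_eq_integral_smul one_ne_zero] at e1
    have e2 : ∀ t, gaussianPDFReal 0 1 t • k t = (√(2 * π))⁻¹ * (k t * exp (-(t ^ 2 / 2))) := by
      intro t
      simp only [gaussianPDFReal, smul_eq_mul, sub_zero, NNReal.coe_one, mul_one]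
      rw [neg_div]; ring
    simp_rw [e2] at e1
    rw [integral_const_mul] at e1
    refine (mul_eq_zero.mp e1).resolve_left ?_
    positivity
  set I : ℝ → ℝ := fun x => ∫ t in Set.Iic x, k t * exp (-(t ^ 2 / 2)) with hI
  have hIderiv : ∀ x, HasDerivAt I (k x * exp (-(x ^ 2 / 2))) x := by
    intro x
    have e : I = fun x => I 0 + ∫ t in (0 : ℝ)..x, k t * exp (-(t ^ 2 / 2)) := by
      funext y
      rw [← intervalIntegral.integral_Iic_sub_Iic hkI.integrableOn hkI.integrableOn]
      simp [hI]
    rw [e]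
    refine HasDerivAt.const_add _ ?_
    have hcont : Continuous fun t => k t * exp (-(t ^ 2 / 2)) := by fun_prop
    exact intervalIntegral.integral_hasDerivAt_right (hcont.intervalIntegrable _ _)
      (hcont.stronglyMeasurableAtFilter _ _) hcont.continuousAt
  set f : ℝ → ℝ := fun x => exp (x ^ 2 / 2) * I x with hf
  have hfd : ∀ x, HasDerivAt f (x * f x + k x) x := by
    intro x
    refine ((hasDerivAt_exp_sq_div_two x).mul (hIderiv x)).congr_deriv ?_
    have : exp (x ^ 2 / 2) * exp (-(x ^ 2 / 2)) = 1 := by rw [← exp_add]; simp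
    simp only [hf]
    linear_combination k x * this
  have hfc : Continuous f := continuous_iff_continuousAt.2 fun x => (hfd x).continuousAt
  have hxf : ∀ x, |x * f x| ≤ 1 := by
    intro x
    have hII : |x| * |I x| ≤ exp (-(x ^ 2 / 2)) := by
      rcases le_total 0 x with hx | hx
      · have hs := intervalIntegral.integral_Iic_add_Ioi (b := x) hkI.integrableOn hkI.integrableOn
        rw [hkzero] at hs
        have : I x = -∫ t in Set.Ioi x, k t * exp (-(t ^ 2 / 2)) := by
          simp only [hI]; linarith
        rw [this, abs_neg, abs_of_nonneg hx]
        exact mul_abs_integral_Ioi_le hkc hb hx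
      · have := mul_abs_integral_Ioi_le (k := fun t => k (-t)) (by fun_prop) (fun t => hb (-t))
          (x := -x) (by linarith)
        have e := integral_comp_neg_Iic x fun t => k (-t) * exp (-(t ^ 2 / 2))
        simp only [neg_neg, neg_sq] at e this
        rw [← e] at this
        rw [abs_of_nonpos hx]
        exact this
    calc |x * f x| = exp (x ^ 2 / 2) * (|x| * |I x|) := by
          simp only [hf, abs_mul, abs_exp]; ring
      _ ≤ exp (x ^ 2 / 2) * exp (-(x ^ 2 / 2)) := by gcongr
      _ = 1 := by rw [← exp_add]; simp
  refine ⟨f, fun x => x * f x + k x, hfd, by fun_prop, fun x => ?_, fun x => ?_⟩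
  · refine (abs_add_le _ _).trans ?_
    linarith [hxf x, hb x]
  · simp only [hk]; ring

/-- Integral of a function that factors in polar coordinates. -/
lemma integral_eq_toSphere_mul {E : Type*} [NormedAddCommGroup E] [NormedSpace ℝ E]
    [MeasurableSpace E] [BorelSpace E] [FiniteDimensional ℝ E] [Nontrivial E] (μ : Measure E)
    [μ.IsAddHaarMeasure] (A : Metric.sphere (0 : E) 1 → ℝ) (B : ℝ → ℝ) (F : E → ℝ)
    (hF : ∀ (r : ℝ) (ω : Metric.sphere (0 : E) 1), 0 < r → F (r • (ω : E)) = A ω * B r) :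
    ∫ x, F x ∂μ = (∫ ω, A ω ∂μ.toSphere) *
      ∫ r : Set.Ioi (0 : ℝ), B r ∂(Measure.volumeIoiPow (Module.finrank ℝ E - 1)) := by
  calc ∫ x, F x ∂μ = ∫ x : ({(0)}ᶜ : Set E), F x ∂(μ.comap (↑)) := by
        rw [integral_subtype_comap (measurableSet_singleton _).compl F, restrict_compl_singleton]
    _ = ∫ x, A x.1 * B x.2 ∂μ.toSphere.prod (.volumeIoiPow (Module.finrank ℝ E - 1)) := by
        rw [← μ.measurePreserving_homeomorphUnitSphereProd.integral_comp
          (Homeomorph.measurableEmbedding _)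
          (fun x : Metric.sphere (0 : E) 1 × Set.Ioi (0 : ℝ) => A x.1 * B x.2)]
        refine integral_congr_ae (Filter.Eventually.of_forall fun x => ?_)
        simp only
        rw [← hF _ _ (homeomorphUnitSphereProd E x).2.2]
        congr 1
        have hx : ‖(x : E)‖ ≠ 0 := norm_ne_zero_iff.2 x.2
        simp [smul_smul, hx]
    _ = _ := integral_prod_mul A fun r : Set.Ioi (0 : ℝ) => B r

namespace MvPolynomial

variable {ι : Type*}

/-- The function on Euclidean space defined by a polynomial. -/
def toEuclideanFun (p : MvPolynomial ι ℝ) (x : EuclideanSpace ℝ ι) : ℝ := eval (fun i => x i) p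

lemma IsHomogeneous.toEuclideanFun_smul {p : MvPolynomial ι ℝ} {m : ℕ} (hp : p.IsHomogeneous m)
    (r : ℝ) (x : EuclideanSpace ℝ ι) :
    p.toEuclideanFun (r • x) = r ^ m * p.toEuclideanFun x := by
  simp only [toEuclideanFun, eval_eq, Finset.mul_sum]
  refine Finset.sum_congr rfl fun d hd => ?_
  have hdeg := hp (mem_support_iff.1 hd)
  simp only [PiLp.smul_apply, smul_eq_mul, mul_pow, Finset.prod_mul_distrib,
    Finset.prod_pow_eq_pow_sum]
  have : ∑ i ∈ d.support, d i = m := by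
    simpa [Finsupp.weight_apply, Finsupp.sum] using hdeg
  rw [this]; ring

variable [Fintype ι]

lemma hasFDerivAt_toEuclideanFun (p : MvPolynomial ι ℝ) (x : EuclideanSpace ℝ ι) :
    HasFDerivAt p.toEuclideanFun
      (∑ i, (pderiv i p).toEuclideanFun x • (EuclideanSpace.proj i : EuclideanSpace ℝ ι →L[ℝ] ℝ))
      x := by
  classical
  induction p using MvPolynomial.induction_on with
  | C a =>
    have : (C a : MvPolynomial ι ℝ).toEuclideanFun = fun _ => a := by
      funext y; simp [toEuclideanFun]
    rw [this]
    refine (hasFDerivAt_const a x).congr_fderiv ?_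
    simp [toEuclideanFun]
  | add p q hp hq =>
    have : (p + q).toEuclideanFun = fun y => p.toEuclideanFun y + q.toEuclideanFun y := by
      funext y; simp [toEuclideanFun]
    rw [this]
    refine (hp.add hq).congr_fderiv ?_
    simp [toEuclideanFun, add_smul, Finset.sum_add_distrib]
  | mul_X p j hp =>
    have : (p * X j).toEuclideanFun =
        fun y => p.toEuclideanFun y * (EuclideanSpace.proj (𝕜 := ℝ) j) y := by
      funext y; simp [toEuclideanFun]
    rw [this]
    refine (hp.mul (EuclideanSpace.proj (𝕜 := ℝ) j).hasFDerivAt).congr_fderiv ?_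
    ext v
    simp [toEuclideanFun, pderiv_X, Pi.single_apply, Finset.mul_sum, add_mul,
      Finset.sum_add_distrib, apply_ite, ite_mul, mul_assoc]

lemma contDiff_toEuclideanFun (p : MvPolynomial ι ℝ) {m : WithTop ℕ∞} :
    ContDiff ℝ m p.toEuclideanFun := by
  have := AnalyticOnNhd.eval_continuousLinearMap' (𝕜 := ℝ)
    (fun i => (EuclideanSpace.proj i : EuclideanSpace ℝ ι →L[ℝ] ℝ)) p
  exact this.contDiff

/-- Up to a radial factor, the gradient of the degree-zero homogeneous extension of a homogeneous
polynomial `q` of degree `ℓ`. -/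
def tangential (q : MvPolynomial ι ℝ) (ℓ : ℕ) (i : ι) : MvPolynomial ι ℝ :=
  (∑ j, X j ^ 2) * pderiv i q - C (ℓ : ℝ) * q * X i

variable {q : MvPolynomial ι ℝ} {ℓ : ℕ}

lemma isHomogeneous_sum_X_sq : (∑ j, X j ^ 2 : MvPolynomial ι ℝ).IsHomogeneous 2 :=
  IsHomogeneous.sum _ _ _ fun j _ => by simpa using (isHomogeneous_X ℝ j).pow 2

lemma IsHomogeneous.sum_tangential_mul_X (hq : q.IsHomogeneous ℓ) :
    ∑ i, tangential q ℓ i * X i = 0 := by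
  have e : ∑ i, tangential q ℓ i * X i =
      (∑ j, X j ^ 2) * (∑ i, X i * pderiv i q) - C (ℓ : ℝ) * q * ∑ i, X i ^ 2 := by
    simp only [tangential, Finset.mul_sum, ← Finset.sum_sub_distrib]
    refine Finset.sum_congr rfl fun i _ => ?_
    ring
  rw [e, hq.sum_X_mul_pderiv, nsmul_eq_mul]
  simp; ring

lemma IsHomogeneous.sum_pderiv_tangential (hq : q.IsHomogeneous ℓ)
    (hharm : ∑ i, pderiv i (pderiv i q) = 0) :
    ∑ i, pderiv i (tangential q ℓ i) =
      C (-(ℓ * ((ℓ : ℝ) + Fintype.card ι - 2))) * q := by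
  classical
  have hN : ∀ i : ι, pderiv i (∑ j, X j ^ 2 : MvPolynomial ι ℝ) = 2 * X i := by
    intro i
    simp [pderiv_X, Pi.single_apply]
  have e : ∑ i, pderiv i (tangential q ℓ i) =
      2 * (∑ i, X i * pderiv i q) + (∑ j, X j ^ 2) * (∑ i, pderiv i (pderiv i q))
       - C (ℓ : ℝ) * (∑ i, X i * pderiv i q) - ∑ _i : ι, C (ℓ : ℝ) * q := by
    simp only [tangential, Finset.mul_sum, ← Finset.sum_sub_distrib, ← Finset.sum_add_distrib]
    refine Finset.sum_congr rfl fun i _ => ?_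
    rw [map_sub, pderiv_mul, hN, pderiv_mul, pderiv_C_mul, pderiv_X_self]
    ring
  rw [e, hharm, hq.sum_X_mul_pderiv]
  simp only [nsmul_eq_mul, Finset.sum_const, Finset.card_univ, map_neg, map_mul, map_sub, map_add,
    map_natCast, map_ofNat]
  ring

lemma IsHomogeneous.sum_tangential_mul_pderiv_isHomogeneous (hq : q.IsHomogeneous ℓ)
    (hl : 1 ≤ ℓ) : (∑ i, tangential q ℓ i * pderiv i q).IsHomogeneous (2 * ℓ) := by
  refine IsHomogeneous.sum _ _ _ fun i _ => ?_
  have h1 : (tangential q ℓ i).IsHomogeneous (ℓ + 1) := by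
    refine IsHomogeneous.sub ?_ ?_
    · have := isHomogeneous_sum_X_sq.mul (hq.pderiv (i := i))
      rwa [show 2 + (ℓ - 1) = ℓ + 1 by omega] at this
    · simpa using ((isHomogeneous_C ι (ℓ : ℝ)).mul hq).mul (isHomogeneous_X ℝ i)
  have := h1.mul (hq.pderiv (i := i))
  rwa [show ℓ + 1 + (ℓ - 1) = 2 * ℓ by omega] at this

lemma fderiv_toEuclideanFun_apply (p : MvPolynomial ι ℝ) (x v : EuclideanSpace ℝ ι) :
    fderiv ℝ p.toEuclideanFun x v = ∑ i, (pderiv i p).toEuclideanFun x * v i := by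
  rw [(hasFDerivAt_toEuclideanFun p x).fderiv]
  simp

/-- Integration by parts of a compactly supported function against a polynomial vector field. -/
lemma integral_sum_mul_fderiv_single (W : ι → MvPolynomial ι ℝ) {T : EuclideanSpace ℝ ι → ℝ}
    [DecidableEq ι] (hT : ContDiff ℝ 1 T) (hc : HasCompactSupport T) :
    ∫ x, fderiv ℝ T x (WithLp.toLp 2 fun i => (W i).toEuclideanFun x) =
      -∫ x, (∑ i, pderiv i (W i)).toEuclideanFun x * T x := by
  have hdT : Continuous (fderiv ℝ T) := hT.continuous_fderiv one_ne_zero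
  have hWc : ∀ p : MvPolynomial ι ℝ, Continuous p.toEuclideanFun := fun p =>
    (contDiff_toEuclideanFun p (m := 0)).continuous
  have hI1 : ∀ (p : MvPolynomial ι ℝ) (v : EuclideanSpace ℝ ι),
      Integrable (fun x => p.toEuclideanFun x * fderiv ℝ T x v) := fun p v =>
    Continuous.integrable_of_hasCompactSupport ((hWc p).mul (hdT.clm_apply continuous_const))
      ((hc.fderiv_apply (𝕜 := ℝ) v).mul_left)
  have hI2 : ∀ (p : MvPolynomial ι ℝ), Integrable (fun x => p.toEuclideanFun x * T x) := fun p =>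
    Continuous.integrable_of_hasCompactSupport ((hWc p).mul hT.continuous) hc.mul_left
  have hpart : ∀ (i : ι), ∫ x, (W i).toEuclideanFun x * fderiv ℝ T x (EuclideanSpace.single i 1) =
      -∫ x, (pderiv i (W i)).toEuclideanFun x * T x := by
    intro i
    have hd : ∀ x, fderiv ℝ (W i).toEuclideanFun x (EuclideanSpace.single i 1) =
        (pderiv i (W i)).toEuclideanFun x := fun x => by
      rw [fderiv_toEuclideanFun_apply]
      simp
    simp_rw [← hd]
    refine integral_mul_fderiv_eq_neg_fderiv_mul_of_integrable ?_ (hI1 _ _) (hI2 _) ?_ ?_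
    · simp_rw [hd]; exact hI2 _
    · exact fun x _ => (hasFDerivAt_toEuclideanFun _ x).differentiableAt
    · exact fun x _ => hT.differentiable one_ne_zero x
  calc _ = ∫ x, ∑ i, (W i).toEuclideanFun x * fderiv ℝ T x (EuclideanSpace.single i 1) := by
        refine integral_congr_ae (Filter.Eventually.of_forall fun x => ?_)
        have : (WithLp.toLp 2 fun i => (W i).toEuclideanFun x) =
            ∑ i, (W i).toEuclideanFun x • (EuclideanSpace.single i (1 : ℝ)) := by
          ext j
          simp [Finset.sum_apply, Pi.single_apply]
        simp only
        rw [this, map_sum]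
        simp
    _ = ∑ i, -∫ x, (pderiv i (W i)).toEuclideanFun x * T x := by
        rw [integral_finsetSum _ fun i _ => hI1 _ _]
        exact Finset.sum_congr rfl fun i _ => hpart i
    _ = _ := by
        rw [Finset.sum_neg_distrib, ← integral_finsetSum _ fun i _ => hI2 _]
        congr 1
        refine integral_congr_ae (Filter.Eventually.of_forall fun x => ?_)
        simp [toEuclideanFun, Finset.sum_mul]

lemma inner_toLp_eq_zero_of_isHomogeneous (hq : q.IsHomogeneous ℓ) (x : EuclideanSpace ℝ ι) :
    ⟪x, WithLp.toLp 2 fun i => (tangential q ℓ i).toEuclideanFun x⟫ = 0 := by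
  have := congrArg (fun p : MvPolynomial ι ℝ => p.toEuclideanFun x) hq.sum_tangential_mul_X
  simpa [toEuclideanFun, PiLp.inner_apply] using this

end MvPolynomial

lemma hasFDerivAt_comp_norm_sq_apply_eq_zero {E : Type*} [NormedAddCommGroup E]
    [InnerProductSpace ℝ E] {R : ℝ → ℝ} {x : E} (hR : DifferentiableAt ℝ R (‖x‖ ^ 2)) :
    ∃ D : E →L[ℝ] ℝ, HasFDerivAt (fun y => R (‖y‖ ^ 2)) D x ∧ ∀ v, ⟪x, v⟫ = 0 → D v = 0 := by
  refine ⟨_, hR.hasDerivAt.comp_hasFDerivAt x (hasStrictFDerivAt_norm_sq x).hasFDerivAt, ?_⟩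
  intro v hv
  simp [hv]

namespace MvPolynomial

variable {ι : Type*} [Fintype ι] {q : MvPolynomial ι ℝ} {ℓ : ℕ}

/-- Integration by parts on the sphere for a spherical harmonic. -/
theorem IsHomogeneous.integral_toSphere_eq_zero [Nonempty ι] (hq : q.IsHomogeneous ℓ) (hl : 1 ≤ ℓ)
    (hharm : ∑ i, pderiv i (pderiv i q) = 0) {f f' : ℝ → ℝ} (hf : ∀ x, HasDerivAt f (f' x) x)
    (hf' : Continuous f') :
    ∫ ω : Metric.sphere (0 : EuclideanSpace ℝ ι) 1,
      (f' (q.toEuclideanFun ω) * (∑ i, tangential q ℓ i * pderiv i q).toEuclideanFun ω -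
        ℓ * ((ℓ : ℝ) + Fintype.card ι - 2) * (q.toEuclideanFun ω * f (q.toEuclideanFun ω)))
      ∂(volume : Measure (EuclideanSpace ℝ ι)).toSphere = 0 := by
  classical
  set E := EuclideanSpace ℝ ι
  set lam : ℝ := ℓ * ((ℓ : ℝ) + Fintype.card ι - 2) with hlam
  set Γ : MvPolynomial ι ℝ := ∑ i, tangential q ℓ i * pderiv i q with hΓ
  have hf1 : ContDiff ℝ 1 f := by
    rw [contDiff_one_iff_deriv]
    refine ⟨fun x => (hf x).differentiableAt, ?_⟩
    rwa [show deriv f = f' from _root_.funext fun x => (hf x).deriv]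
  let ψ : ContDiffBump (2 : ℝ) := ⟨1 / 2, 1, by norm_num, by norm_num⟩
  have hψ0 : ∀ s : ℝ, s ≤ 1 → ψ s = 0 := fun s hs => ψ.zero_of_le_dist (by
    change (1 : ℝ) ≤ _
    rw [dist_eq, abs_of_nonpos] <;> linarith)
  have hψ3 : ∀ s : ℝ, 3 ≤ s → ψ s = 0 := fun s hs => ψ.zero_of_le_dist (by
    change (1 : ℝ) ≤ _
    rw [dist_eq, abs_of_nonneg] <;> linarith)
  have hψd : ContDiff ℝ 1 ψ := ψ.contDiff
  have hsupp : ∀ g : E → ℝ, HasCompactSupport fun x : E => ψ (‖x‖ ^ 2) * g x := by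
    intro g
    refine HasCompactSupport.of_support_subset_isCompact (isCompact_closedBall (0 : E) 2) ?_
    intro x hx
    rw [mem_closedBall_zero_iff]
    by_contra hlt
    refine hx ?_
    simp only
    rw [hψ3 _ (by nlinarith), zero_mul]
  set G : ℝ → ℝ := fun s => (√s)⁻¹ ^ ℓ with hG
  have hGd : ∀ s : ℝ, 0 < s → ContDiffAt ℝ 1 G s := fun s hs =>
    ((contDiffAt_sqrt hs.ne').inv (sqrt_pos.2 hs).ne').pow ℓ
  set T : E → ℝ := fun x => ψ (‖x‖ ^ 2) * f (q.toEuclideanFun x * G (‖x‖ ^ 2)) with hT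
  have hT0 : ∀ᶠ y in nhds (0 : E), T y = 0 := by
    filter_upwards [Metric.ball_mem_nhds (0 : E) one_pos] with y hy
    rw [mem_ball_zero_iff] at hy
    simp only [hT]
    rw [hψ0 _ (by nlinarith [norm_nonneg y]), zero_mul]
  have hTd : ContDiff ℝ 1 T := by
    rw [contDiff_iff_contDiffAt]
    intro x
    rcases eq_or_ne x 0 with rfl | hx
    · exact (contDiffAt_const (c := (0 : ℝ))).congr_of_eventuallyEq hT0
    · have hn : ContDiffAt ℝ 1 (fun y : E => ‖y‖ ^ 2) x := (contDiff_norm_sq ℝ).contDiffAt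
      refine (hψd.contDiffAt.comp x hn).mul (hf1.contDiffAt.comp x ?_)
      refine (contDiff_toEuclideanFun q).contDiffAt.mul ?_
      exact ContDiffAt.comp (g := G) x (hGd (‖x‖ ^ 2) (by positivity)) hn
  set V : E → E := fun x => WithLp.toLp 2 fun i => (tangential q ℓ i).toEuclideanFun x with hV
  have hDT : ∀ x : E, x ≠ 0 → fderiv ℝ T x (V x) =
      ψ (‖x‖ ^ 2) * (f' (q.toEuclideanFun x * G (‖x‖ ^ 2)) *
        (G (‖x‖ ^ 2) * Γ.toEuclideanFun x)) := by
    intro x hx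
    have hort : ⟪x, V x⟫ = 0 := inner_toLp_eq_zero_of_isHomogeneous hq x
    obtain ⟨D1, hD1, hD1'⟩ := hasFDerivAt_comp_norm_sq_apply_eq_zero (x := x)
      (hψd.differentiable one_ne_zero (‖x‖ ^ 2))
    obtain ⟨D2, hD2, hD2'⟩ := hasFDerivAt_comp_norm_sq_apply_eq_zero (x := x)
      ((hGd (‖x‖ ^ 2) (by positivity)).differentiableAt one_ne_zero)
    have hDq := (hasFDerivAt_toEuclideanFun q x).differentiableAt.hasFDerivAt
    have hD := hD1.mul ((hf _).comp_hasFDerivAt x (hDq.mul hD2))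
    have hΓe : fderiv ℝ q.toEuclideanFun x (V x) = Γ.toEuclideanFun x := by
      rw [fderiv_toEuclideanFun_apply]
      simp [hΓ, hV, toEuclideanFun, mul_comm]
    have := congrArg (fun L : E →L[ℝ] ℝ => L (V x)) hD.fderiv
    refine Eq.trans this ?_
    simp [hD1' _ hort, hD2' _ hort, hΓe]
  have hparts := integral_sum_mul_fderiv_single (tangential q ℓ) hTd (hsupp _)
  rw [hq.sum_pderiv_tangential hharm] at hparts
  have hTI : Integrable fun x => fderiv ℝ T x (V x) := by
    refine Continuous.integrable_of_hasCompactSupport ?_ ?_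
    · refine (hTd.continuous_fderiv one_ne_zero).clm_apply ?_
      refine (PiLp.continuous_toLp 2 _).comp (continuous_pi fun i => ?_)
      exact (contDiff_toEuclideanFun _ (m := 0)).continuous
    · have h1 : HasCompactSupport (fderiv ℝ T) := HasCompactSupport.fderiv (𝕜 := ℝ) (hsupp _)
      refine h1.mono fun x hx h0 => hx ?_
      simp only
      rw [h0]; rfl
  have hTI2 : Integrable fun x => lam * (q.toEuclideanFun x * T x) :=
    (Continuous.integrable_of_hasCompactSupport
      ((contDiff_toEuclideanFun q (m := 0)).continuous.mul hTd.continuous)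
      (hsupp _).mul_left).const_mul lam
  have hzero : ∫ x, (fderiv ℝ T x (V x) - lam * (q.toEuclideanFun x * T x)) = 0 := by
    rw [integral_sub hTI hTI2, sub_eq_zero]
    refine hparts.trans ?_
    rw [← integral_neg]
    refine integral_congr_ae (Filter.Eventually.of_forall fun x => ?_)
    simp only [toEuclideanFun, map_mul, eval_C]
    ring
  rw [integral_eq_toSphere_mul (volume : Measure E) _ (fun r => ψ (r ^ 2) * r ^ ℓ) _ ?_] at hzero
  · refine (mul_eq_zero.mp hzero).resolve_right fun hB => ?_
    have hpos : 0 < ∫ x : E, ψ (‖x‖ ^ 2) * ‖x‖ ^ ℓ := by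
      obtain ⟨u, hu⟩ := exists_norm_eq E (sqrt_nonneg 2)
      refine Continuous.integral_pos_of_hasCompactSupport_nonneg_nonzero (x := u) ?_ (hsupp _)
        (fun x => mul_nonneg ψ.nonneg (by positivity)) ?_
      · exact (hψd.continuous.comp (by fun_prop)).mul (by fun_prop)
      · rw [hu, sq_sqrt zero_le_two, ψ.one_of_mem_closedBall]
        · positivity
        · exact Metric.mem_closedBall_self ψ.rIn_pos.le
    rw [integral_eq_toSphere_mul (volume : Measure E) (fun _ => 1)
      (fun r => ψ (r ^ 2) * r ^ ℓ) _ ?_, hB, mul_zero] at hpos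
    · exact lt_irrefl _ hpos
    · intro r ω hr
      have : ‖r • (ω : E)‖ = r := by simp [norm_smul, abs_of_pos hr]
      rw [this, one_mul]
  · intro r ω hr
    have hn : ‖r • (ω : E)‖ = r := by simp [norm_smul, abs_of_pos hr]
    have hne : r • (ω : E) ≠ 0 := by rw [← norm_pos_iff, hn]; exact hr
    have hGr : G (r ^ 2) = (r⁻¹) ^ ℓ := by simp only [hG]; rw [sqrt_sq hr.le]
    have hrr : r ^ ℓ * r⁻¹ ^ ℓ = 1 := by rw [← mul_pow, mul_inv_cancel₀ hr.ne', one_pow]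
    rw [hDT _ hne]
    simp only [hT]
    rw [hn, hGr, hq.toEuclideanFun_smul,
      (hq.sum_tangential_mul_pderiv_isHomogeneous hl).toEuclideanFun_smul,
      show r ^ ℓ * q.toEuclideanFun ω * r⁻¹ ^ ℓ = q.toEuclideanFun ω by
        linear_combination q.toEuclideanFun ω * hrr, two_mul, pow_add]
    linear_combination (ψ (r ^ 2) * f' (q.toEuclideanFun ω) * r ^ ℓ * Γ.toEuclideanFun ω) * hrr

end MvPolynomial

lemma dTV_le_of_forall_measurableSet {μ ν : Measure ℝ} {C : ℝ}
    (h : ∀ A, MeasurableSet A → |(μ A).toReal - (ν A).toReal| ≤ C) : dTV μ ν ≤ C :=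
  haveI : Nonempty {s : Set ℝ // MeasurableSet s} := ⟨⟨∅, MeasurableSet.empty⟩⟩
  ciSup_le fun s => h s.1 s.2

lemma isProbabilityMeasure_sphereUniform (ι : Type*) [Fintype ι] [Nonempty ι] :
    IsProbabilityMeasure (sphereUniform ι) := by
  refine ⟨?_⟩
  rw [sphereUniform, Measure.smul_apply, smul_eq_mul]
  refine ENNReal.inv_mul_cancel ?_ (measure_ne_top _ _)
  rw [Ne, Measure.measure_univ_eq_zero]
  exact Measure.toSphere_ne_zero _

namespace MvPolynomial

variable {ι : Type*} [Fintype ι] {q : MvPolynomial ι ℝ} {ℓ : ℕ}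

lemma gradient_toEuclideanFun (x : EuclideanSpace ℝ ι) :
    gradient q.toEuclideanFun x = WithLp.toLp 2 fun i => (pderiv i q).toEuclideanFun x := by
  refine ext_inner_right ℝ fun v => ?_
  rw [gradient, InnerProductSpace.toDual_symm_apply, fderiv_toEuclideanFun_apply]
  simp [PiLp.inner_apply, mul_comm]

lemma IsHomogeneous.norm_sphGrad_sq (hq : q.IsHomogeneous ℓ) {x : EuclideanSpace ℝ ι}
    (hx : ‖x‖ = 1) : ‖sphGrad q.toEuclideanFun x‖ ^ 2 =
      (∑ i, tangential q ℓ i * pderiv i q).toEuclideanFun x := by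
  have hxx : ∑ j, x j ^ 2 = 1 := by
    rw [← EuclideanSpace.real_norm_sq_eq, hx, one_pow]
  have heul : ∑ i, x i * (pderiv i q).toEuclideanFun x = ℓ * q.toEuclideanFun x := by
    have := congrArg (fun p : MvPolynomial ι ℝ => p.toEuclideanFun x) hq.sum_X_mul_pderiv
    simpa [toEuclideanFun] using this
  have hin : ⟪gradient q.toEuclideanFun x, x⟫ = ℓ * q.toEuclideanFun x := by
    rw [gradient_toEuclideanFun, ← heul]
    simp [PiLp.inner_apply]
  have hng : ‖gradient q.toEuclideanFun x‖ ^ 2 = ∑ i, (pderiv i q).toEuclideanFun x ^ 2 := by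
    rw [gradient_toEuclideanFun, EuclideanSpace.real_norm_sq_eq]
  have hright : (∑ i, tangential q ℓ i * pderiv i q).toEuclideanFun x =
      ∑ i, (pderiv i q).toEuclideanFun x ^ 2 - ℓ * q.toEuclideanFun x *
        ∑ i, x i * (pderiv i q).toEuclideanFun x := by
    rw [Finset.mul_sum, ← Finset.sum_sub_distrib]
    simp only [toEuclideanFun, tangential, map_sum, map_mul, map_sub, map_pow, eval_X, eval_C, hxx]
    refine Finset.sum_congr rfl fun i _ => ?_
    ring
  rw [hright, heul, sphGrad, norm_sub_sq_real, norm_smul, inner_smul_right, hin, hng, hx,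
    norm_eq_abs, mul_one, sq_abs]
  ring

/-- Stein-type identity for a spherical harmonic under the uniform measure on the sphere. -/
theorem IsHomogeneous.integral_sphereUniform_deriv_mul [Nonempty ι] (hq : q.IsHomogeneous ℓ)
    (hl : 1 ≤ ℓ) (hharm : ∑ i, pderiv i (pderiv i q) = 0) {f f' : ℝ → ℝ}
    (hf : ∀ x, HasDerivAt f (f' x) x) (hf' : Continuous f') :
    ∫ ω : Metric.sphere (0 : EuclideanSpace ℝ ι) 1,
      (f' (q.toEuclideanFun ω) * ‖sphGrad q.toEuclideanFun ω‖ ^ 2 -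
        ℓ * ((ℓ : ℝ) + Fintype.card ι - 2) * (q.toEuclideanFun ω * f (q.toEuclideanFun ω)))
      ∂(sphereUniform ι) = 0 := by
  rw [sphereUniform, integral_smul_measure]
  convert smul_zero _
  rw [← hq.integral_toSphere_eq_zero hl hharm hf hf']
  refine integral_congr_ae (Filter.Eventually.of_forall fun ω => ?_)
  simp only
  rw [hq.norm_sphGrad_sq (norm_eq_of_mem_sphere ω)]

end MvPolynomial

theorem stmt8 (n ℓ : ℕ) (hn : 2 ≤ n) (hl : 1 ≤ ℓ)
    (q : MvPolynomial (Fin n) ℝ) (hq : q.IsHomogeneous ℓ)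
    (hharm : ∑ i : Fin n, MvPolynomial.pderiv i (MvPolynomial.pderiv i q) = 0)
    (Q : EuclideanSpace ℝ (Fin n) → ℝ)
    (hQ : ∀ x, Q x = MvPolynomial.eval (fun i => x i) q)
    (hnorm : ∫ x : Metric.sphere (0 : EuclideanSpace ℝ (Fin n)) 1,
        (Q x) ^ 2 ∂(sphereUniform (Fin n)) = 1)
    (lam : ℝ) (hlam : lam = ℓ * ((ℓ : ℝ) + n - 2)) :
    dTV (MeasureTheory.Measure.map
          (fun x : Metric.sphere (0 : EuclideanSpace ℝ (Fin n)) 1 => Q x)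
          (sphereUniform (Fin n)))
        (gaussianReal 0 1)
      ≤ (2 / lam) *
        ∫ x : Metric.sphere (0 : EuclideanSpace ℝ (Fin n)) 1,
          |‖sphGrad Q x‖ ^ 2 -
            ∫ y : Metric.sphere (0 : EuclideanSpace ℝ (Fin n)) 1,
              ‖sphGrad Q y‖ ^ 2 ∂(sphereUniform (Fin n))|
          ∂(sphereUniform (Fin n)) := by
  obtain rfl : Q = q.toEuclideanFun := funext hQ
  have : Nonempty (Fin n) := ⟨⟨0, by omega⟩⟩
  have := isProbabilityMeasure_sphereUniform (Fin n)
  set σ := sphereUniform (Fin n)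
  have hlampos : 0 < lam := by
    have h1 : (1 : ℝ) ≤ ℓ := by exact_mod_cast hl
    have h2 : (2 : ℝ) ≤ n := by exact_mod_cast hn
    rw [hlam]
    exact mul_pos (by linarith) (by linarith)
  have hQc : Continuous q.toEuclideanFun :=
    (MvPolynomial.contDiff_toEuclideanFun q (m := 0)).continuous
  have hint : ∀ g : Metric.sphere (0 : EuclideanSpace ℝ (Fin n)) 1 → ℝ, Continuous g →
      Integrable g σ := fun g hg =>
    hg.integrable_of_hasCompactSupport (HasCompactSupport.of_compactSpace g)
  have hQs : Continuous fun x : Metric.sphere (0 : EuclideanSpace ℝ (Fin n)) 1 =>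
      q.toEuclideanFun x := hQc.comp continuous_subtype_val
  have hGs : Continuous fun x : Metric.sphere (0 : EuclideanSpace ℝ (Fin n)) 1 =>
      ‖sphGrad q.toEuclideanFun x‖ ^ 2 := by
    simp_rw [fun x : Metric.sphere (0 : EuclideanSpace ℝ (Fin n)) 1 =>
      hq.norm_sphGrad_sq (norm_eq_of_mem_sphere x)]
    exact (MvPolynomial.contDiff_toEuclideanFun _ (m := 0)).continuous.comp continuous_subtype_val
  have hstein : ∀ f f' : ℝ → ℝ, (∀ x, HasDerivAt f (f' x) x) → Continuous f' →
      ∫ x : Metric.sphere (0 : EuclideanSpace ℝ (Fin n)) 1,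
        (f' (q.toEuclideanFun x) * ‖sphGrad q.toEuclideanFun x‖ ^ 2 -
          lam * (q.toEuclideanFun x * f (q.toEuclideanFun x))) ∂σ = 0 := by
    intro f f' hf hf'
    have := hq.integral_sphereUniform_deriv_mul hl hharm hf hf'
    rwa [Fintype.card_fin, ← hlam] at this
  have hmean : ∫ x : Metric.sphere (0 : EuclideanSpace ℝ (Fin n)) 1,
      ‖sphGrad q.toEuclideanFun x‖ ^ 2 ∂σ = lam := by
    have h := hstein (fun x => x) (fun _ => 1) hasDerivAt_id' continuous_const
    simp only [one_mul, ← pow_two] at h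
    rw [integral_sub (hint _ hGs) (hint (fun x => lam * q.toEuclideanFun x ^ 2) (by fun_prop)),
      integral_const_mul, hnorm] at h
    linarith
  rw [hmean]
  have : IsProbabilityMeasure (Measure.map (fun x : Metric.sphere (0 : EuclideanSpace ℝ (Fin n)) 1
      => q.toEuclideanFun x) σ) := Measure.isProbabilityMeasure_map hQs.aemeasurable
  refine dTV_le_of_forall_measurableSet (abs_measure_sub_le_of_continuous _ _ _ ?_)
  intro h hc h0 h1
  obtain ⟨f, f', hf, hf'c, hf'b, hsol⟩ := exists_stein_solution hc h0 h1
  have hfc : Continuous f := continuous_iff_continuousAt.2 fun x => (hf x).continuousAt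
  rw [integral_map hQs.aemeasurable hc.aestronglyMeasurable]
  have hs := hstein f f' hf hf'c
  have hrep : ∫ x : Metric.sphere (0 : EuclideanSpace ℝ (Fin n)) 1, h (q.toEuclideanFun x) ∂σ -
      ∫ t, h t ∂(gaussianReal 0 1) =
      ∫ x : Metric.sphere (0 : EuclideanSpace ℝ (Fin n)) 1, -(f' (q.toEuclideanFun x) / lam *
        (‖sphGrad q.toEuclideanFun x‖ ^ 2 - lam)) ∂σ := by
    have e1 : ∫ x : Metric.sphere (0 : EuclideanSpace ℝ (Fin n)) 1, h (q.toEuclideanFun x) ∂σ -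
        ∫ t, h t ∂(gaussianReal 0 1) = ∫ x : Metric.sphere (0 : EuclideanSpace ℝ (Fin n)) 1,
          (f' (q.toEuclideanFun x) - q.toEuclideanFun x * f (q.toEuclideanFun x)) ∂σ := by
      simp_rw [hsol]
      rw [integral_sub (hint (fun x => h (q.toEuclideanFun x)) (hc.comp hQs)) (integrable_const _)]
      simp
    rw [e1, ← sub_eq_zero, ← integral_sub]
    rotate_left
    · exact hint _ (by fun_prop)
    · exact hint _ (by fun_prop)
    rw [← mul_zero lam⁻¹, ← hs, ← integral_const_mul]
    refine integral_congr_ae (Filter.Eventually.of_forall fun x => ?_)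
    simp only
    field_simp
    ring
  rw [hrep, ← integral_const_mul]
  refine abs_integral_le_integral_abs.trans (integral_mono (hint _ (by fun_prop))
    (hint _ (by fun_prop)) fun x => ?_)
  simp only [abs_neg, abs_mul, abs_div, abs_of_pos hlampos]
  gcongr
  exact hf'b _

end
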